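/- arXiv:math/9907038 — 6 statements merged into one kernel-verified Lean document; each statement's English description precedes it below -/
import Mathlib

section
/- Let φ, ψ : H → H be defined by φ(t) := m((id ⊗ S̃)(F·(t⊗1)·F⁻¹)) and ψ(t) := m((id ⊗ S)(F⁻¹·(t⊗1)·F)), where S̃(x) := u S(x) u'. Then φ(ψ(t)) = t for every t ∈ H; i.e., the map sending a tensor operator for the undeformed Hopf algebra to its twisted counterpart and the reverse map of Lemma 3 are mutually inverse. -/
open TensorProduct HopfAlgebra

/-- Let `H` be a Hopf algebra over a commutative ring `R` with
multiplication `m = LinearMap.mul'`, antipode `S` (assumed to be a unital algebra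
anti-homomorphism), and let `F = Σᵢ fᵢ ⊗ fᵢ'` be an invertible element of `H ⊗ H`
with inverse `F⁻¹ = Σⱼ gⱼ ⊗ gⱼ'`.  Put `u = Σᵢ fᵢ S(fᵢ')`, `u' = Σⱼ S(gⱼ) gⱼ'`
and assume `u u' = u' u = 1`.  With `S̃(x) = u S(x) u'`, the maps
`φ(t) = m((id ⊗ S̃)(F (t⊗1) F⁻¹))` and `ψ(t) = m((id ⊗ S)(F⁻¹ (t⊗1) F))`
satisfy `φ(ψ(t)) = t` for every `t ∈ H`. -/
theorem stmt0 {R H : Type*} [CommRing R] [Semiring H] [HopfAlgebra R H]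
    {ι κ : Type*} [Fintype ι] [Fintype κ]
    (f f' : ι → H) (g g' : κ → H)
    (hanti : ∀ x y : H, (antipode (R := R)) (x * y) = (antipode (R := R)) y * (antipode (R := R)) x)
    (hone : (antipode (R := R)) (1 : H) = 1)
    (hFG : ((∑ i, f i ⊗ₜ[R] f' i) * (∑ j, g j ⊗ₜ[R] g' j) : H ⊗[R] H) = 1)
    (hGF : ((∑ j, g j ⊗ₜ[R] g' j) * (∑ i, f i ⊗ₜ[R] f' i) : H ⊗[R] H) = 1)
    (u u' : H)
    (hu : u = ∑ i, f i * (antipode (R := R)) (f' i))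
    (hu' : u' = ∑ j, (antipode (R := R)) (g j) * g' j)
    (huu' : u * u' = 1) (hu'u : u' * u = 1)
    (Stilde : H →ₗ[R] H)
    (hSt : ∀ x : H, Stilde x = u * (antipode (R := R)) x * u')
    (φ ψ : H → H)
    (hφ : ∀ t : H, φ t = LinearMap.mul' R H
      ((TensorProduct.map LinearMap.id Stilde)
        ((∑ i, f i ⊗ₜ[R] f' i) * (t ⊗ₜ[R] (1 : H)) * (∑ j, g j ⊗ₜ[R] g' j))))
    (hψ : ∀ t : H, ψ t = LinearMap.mul' R H
      ((TensorProduct.map LinearMap.id (antipode (R := R)))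
        ((∑ j, g j ⊗ₜ[R] g' j) * (t ⊗ₜ[R] (1 : H)) * (∑ i, f i ⊗ₜ[R] f' i)))) :
    ∀ t : H, φ (ψ t) = t := by
  have key1 : ∀ x : H, ∑ i, ∑ j, f i * (g j * x * antipode R (g' j)) * antipode R (f' i) = x := by
    intro x
    have h := congrArg (fun z => LinearMap.mul' R H
      ((TensorProduct.map (LinearMap.mulRight R x) (antipode R)) z)) hFG
    simpa [Finset.sum_mul_sum, Algebra.TensorProduct.one_def, hanti, hone, mul_assoc] using h
  have key2 : ∀ x : H, ∑ j, ∑ i, g j * (f i * x * antipode R (f' i)) * antipode R (g' j) = x := by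
    intro x
    have h := congrArg (fun z => LinearMap.mul' R H
      ((TensorProduct.map (LinearMap.mulRight R x) (antipode R)) z)) hGF
    simpa [Finset.sum_mul_sum, Algebra.TensorProduct.one_def, hanti, hone, mul_assoc] using h
  have hA : ∑ j, g j * u * antipode R (g' j) = 1 := by
    rw [← key2 1, hu]
    simp [Finset.mul_sum, Finset.sum_mul, mul_assoc]
  have hψ2 : ∀ t, ψ t = ∑ j, g j * (t * u) * antipode R (g' j) := by
    intro t
    rw [hψ, hu]
    simp [Finset.sum_mul, Finset.mul_sum, hanti, mul_assoc]
    try rw [Finset.sum_comm]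
  have hφ2 : ∀ s, φ s = (∑ i, f i * s * antipode R (f' i)) * u' := by
    intro s
    have e : φ s = (∑ i, f i * s * (∑ j, g j * u * antipode R (g' j)) * antipode R (f' i)) * u' := by
      rw [hφ]
      simp only [Finset.sum_mul, Finset.mul_sum, Algebra.TensorProduct.tmul_mul_tmul, map_sum,
        TensorProduct.map_tmul, LinearMap.mul'_apply, hSt, hanti, LinearMap.id_apply, mul_one,
        mul_assoc]
      try rw [Finset.sum_comm]
    rw [e, hA]
    simp
  intro t
  have h := key1 (t * u)
  rw [hφ2, hψ2]
  simp only [← Finset.mul_sum, ← Finset.sum_mul] at h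
  rw [h, mul_assoc, huu', mul_one]
end

section
/- With S̃(x) := u S(x) u', the following identities hold for every t ∈ H: (i) Σⱼ gⱼ u S(gⱼ') = 1; (ii) m((id ⊗ S̃)(F·(t⊗1)·F⁻¹)) = Σᵢ fᵢ t S(fᵢ') u'; (iii) m((id ⊗ S)(F⁻¹·(t⊗1)·F)) = Σⱼ gⱼ t u S(gⱼ'). -/
open TensorProduct HopfAlgebra

/-- With `H` a Hopf algebra over `R`, antipode `S` a unital algebra
anti-homomorphism, `F = Σᵢ fᵢ ⊗ fᵢ'` invertible with inverse `F⁻¹ = Σⱼ gⱼ ⊗ gⱼ'`,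
`u = Σᵢ fᵢ S(fᵢ')`, `u' = Σⱼ S(gⱼ) gⱼ'`, `u u' = u' u = 1`, and `S̃(x) = u S(x) u'`:
(i) `Σⱼ gⱼ u S(gⱼ') = 1`;
(ii) `m((id ⊗ S̃)(F (t⊗1) F⁻¹)) = Σᵢ fᵢ t S(fᵢ') u'` for all `t`;
(iii) `m((id ⊗ S)(F⁻¹ (t⊗1) F)) = Σⱼ gⱼ t u S(gⱼ')` for all `t`. -/
theorem stmt1 {R H : Type*} [CommRing R] [Semiring H] [HopfAlgebra R H]
    {ι κ : Type*} [Fintype ι] [Fintype κ]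
    (f f' : ι → H) (g g' : κ → H)
    (hanti : ∀ x y : H, (antipode (R := R)) (x * y)
      = (antipode (R := R)) y * (antipode (R := R)) x)
    (hone : (antipode (R := R)) (1 : H) = 1)
    (hFG : ((∑ i, f i ⊗ₜ[R] f' i) * (∑ j, g j ⊗ₜ[R] g' j) : H ⊗[R] H) = 1)
    (hGF : ((∑ j, g j ⊗ₜ[R] g' j) * (∑ i, f i ⊗ₜ[R] f' i) : H ⊗[R] H) = 1)
    (u u' : H)
    (hu : u = ∑ i, f i * (antipode (R := R)) (f' i))
    (hu' : u' = ∑ j, (antipode (R := R)) (g j) * g' j)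
    (huu' : u * u' = 1) (hu'u : u' * u = 1)
    (Stilde : H →ₗ[R] H)
    (hSt : ∀ x : H, Stilde x = u * (antipode (R := R)) x * u') :
    ((∑ j, g j * u * (antipode (R := R)) (g' j)) = 1)
    ∧ (∀ t : H, LinearMap.mul' R H
        ((TensorProduct.map LinearMap.id Stilde)
          ((∑ i, f i ⊗ₜ[R] f' i) * (t ⊗ₜ[R] (1 : H)) * (∑ j, g j ⊗ₜ[R] g' j)))
        = ∑ i, f i * t * (antipode (R := R)) (f' i) * u')
    ∧ (∀ t : H, LinearMap.mul' R H
        ((TensorProduct.map LinearMap.id (antipode (R := R) (A := H)))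
          ((∑ j, g j ⊗ₜ[R] g' j) * (t ⊗ₜ[R] (1 : H)) * (∑ i, f i ⊗ₜ[R] f' i)))
        = ∑ j, g j * t * u * (antipode (R := R)) (g' j)) := by
  have h3 : ∀ t : H, LinearMap.mul' R H
        ((TensorProduct.map LinearMap.id (antipode (R := R) (A := H)))
          ((∑ j, g j ⊗ₜ[R] g' j) * (t ⊗ₜ[R] (1 : H)) * (∑ i, f i ⊗ₜ[R] f' i)))
        = ∑ j, g j * t * u * (antipode (R := R)) (g' j) := by
    intro t
    simp only [Finset.sum_mul, Finset.mul_sum, Algebra.TensorProduct.tmul_mul_tmul, map_sum,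
      TensorProduct.map_tmul, LinearMap.mul'_apply, LinearMap.id_apply, mul_one, hanti, hu,
      mul_assoc]
    first | rfl | exact Finset.sum_comm
  have h1 : (∑ j, g j * u * (antipode (R := R)) (g' j)) = 1 := by
    have h := h3 1
    rw [← Algebra.TensorProduct.one_def, mul_one, hGF, Algebra.TensorProduct.one_def] at h
    simpa [hone] using h.symm
  refine ⟨h1, ?_, h3⟩
  intro t
  have key : ∀ i, f i * t * (antipode (R := R)) (f' i) * u'
      = ∑ j, f i * t * (g j * u * (antipode (R := R)) (g' j)) * (antipode (R := R)) (f' i) * u' := by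
    intro i
    rw [← Finset.sum_mul, ← Finset.sum_mul, ← Finset.mul_sum, h1, mul_one]
  rw [Finset.sum_congr rfl (fun i _ => key i)]
  simp only [Finset.sum_mul, Finset.mul_sum, Algebra.TensorProduct.tmul_mul_tmul, map_sum,
    TensorProduct.map_tmul, LinearMap.mul'_apply, LinearMap.id_apply, mul_one, hanti, hSt,
    mul_assoc]
  first | rfl | exact Finset.sum_comm
end

section
/- Let B be a unital associative algebra with a central element h, containing elements a, ā satisfying āa − aā = 1 − ha², and elements x, y, u, v satisfying the SL_h(2) relations and the determinant relation, with each of x, y, u, v commuting with a and ā. Set a' := a x + ā v and ā' := a u + ā y. Then ā'a' − a'ā' = 1 − h a'²; i.e., the h-deformed oscillator commutation relation is covariant under the action of the Jordanian quantum group SL_h(2). -/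
/-- Let `B` be a unital associative ring with a central element `h`,
containing `a`, `ā` with `ā a - a ā = 1 - h a²`, and elements `x, y, u, v` satisfying
the `SL_h(2)` relations and the determinant relation, each commuting with `a` and `ā`.
Then `a' = a x + ā v`, `ā' = a u + ā y` satisfy `ā' a' - a' ā' = 1 - h a'²`:
the h-deformed oscillator relation is covariant under `SL_h(2)`. -/
theorem stmt6 {B : Type*} [Ring B] (h a abar x y u v : B)
    (hc : ∀ b : B, h * b = b * h)
    (hW : abar * a - a * abar = 1 - h * (a * a))
    (hvx : v * x - x * v = h * (v * v))
    (hux : u * x - x * u = h * (1 - x * x))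
    (hvy : v * y - y * v = h * (v * v))
    (huy : u * y - y * u = h * (1 - y * y))
    (hxy : x * y - y * x = h * (x * v - y * v))
    (hvu : v * u - u * v = h * (x * v + v * y))
    (hdet : x * y - u * v - h * (x * v) = 1)
    (hax : a * x = x * a) (hay : a * y = y * a)
    (hau : a * u = u * a) (hav : a * v = v * a)
    (hbx : abar * x = x * abar) (hby : abar * y = y * abar)
    (hbu : abar * u = u * abar) (hbv : abar * v = v * abar) :
    (a * u + abar * y) * (a * x + abar * v) - (a * x + abar * v) * (a * u + abar * y)
      = 1 - h * ((a * x + abar * v) * (a * x + abar * v)) := by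
  have key : y * x - v * u + h * (v * x) = 1 := by
    have e : y * x - v * u + h * (v * x)
        = (x * y - u * v - h * (x * v)) - (x * y - y * x - h * (x * v - y * v))
          - (v * u - u * v - h * (x * v + v * y))
          + h * ((v * x - x * v) - (v * y - y * v)) := by noncomm_ring
    rw [e, hdet, hxy, hvu, hvx, hvy]
    noncomm_ring
  have sw : ∀ p q r s : B, r * q = q * r → (p * q) * (r * s) = (p * r) * (q * s) := by
    intro p q r s e
    rw [mul_assoc, ← mul_assoc q, ← e, mul_assoc, mul_assoc]
  have hl : ∀ p q : B, h * (p * q) = p * (h * q) := by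
    intro p q
    rw [← mul_assoc, hc p, mul_assoc]
  simp only [add_mul, mul_add]
  rw [sw a u a x hau, sw abar y a x hay, sw a u abar v hbu, sw abar y abar v hby,
    sw a x a u hax, sw abar v a u hav, sw a x abar y hbx, sw abar v abar y hbv,
    sw a x a x hax, sw abar v a x hav, sw a x abar v hbx, sw abar v abar v hbv,
    hl (a * a), hl (abar * a), hl (a * abar), hl (abar * abar)]
  have e1 : u * x = x * u + h * (1 - x * x) := by rw [← hux]; abel
  have e2 : u * v = x * y - h * (x * v) - 1 := by rw [← hdet]; abel
  have e3 : y * x = 1 + v * u - h * (v * x) := by rw [← key]; abel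
  have e4 : v * y = y * v + h * (v * v) := by rw [← hvy]; abel
  have e5 : abar * a = a * abar + (1 - h * (a * a)) := by rw [← hW]; abel
  have e6 : (a * a) * h = h * (a * a) := (hc _).symm
  rw [e1, e2, e3, e4]
  simp only [mul_add, mul_sub, mul_one, e6]
  rw [show (1 : B) = abar * a - a * abar + h * (a * a) by rw [hW]; abel]
  abel
end

section
/- Let B be a unital associative algebra with a central element h, containing elements ξ, η satisfying ξη − ηξ = hξ², and elements x, y, u, v satisfying the SL_h(2) relations and the determinant relation, with each of x, y, u, v commuting with ξ and η. Set ξ' := ξ x + η v and η' := ξ u + η y. Then ξ'η' − η'ξ' = h ξ'²; i.e., the quantum h-plane commutation relation is covariant under the action of the Jordanian quantum group SL_h(2). -/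
/-- Let `B` be a unital associative ring with a central element `h`,
containing `ξ`, `η` with `ξη - ηξ = hξ²` (the quantum h-plane relation), and elements
`x, y, u, v` satisfying the `SL_h(2)` relations and the determinant relation, each
commuting with `ξ` and `η`.  Then `ξ' = ξ x + η v`, `η' = ξ u + η y` satisfy
`ξ'η' - η'ξ' = h ξ'²`: the quantum h-plane relation is covariant under `SL_h(2)`. -/
theorem stmt13 {B : Type*} [Ring B] (h ξ η x y u v : B)
    (hc : ∀ b : B, h * b = b * h)
    (hplane : ξ * η - η * ξ = h * (ξ * ξ))
    (hvx : v * x - x * v = h * (v * v))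
    (hux : u * x - x * u = h * (1 - x * x))
    (hvy : v * y - y * v = h * (v * v))
    (huy : u * y - y * u = h * (1 - y * y))
    (hxy : x * y - y * x = h * (x * v - y * v))
    (hvu : v * u - u * v = h * (x * v + v * y))
    (hdet : x * y - u * v - h * (x * v) = 1)
    (hxix : ξ * x = x * ξ) (hxiy : ξ * y = y * ξ)
    (hxiu : ξ * u = u * ξ) (hxiv : ξ * v = v * ξ)
    (hetx : η * x = x * η) (hety : η * y = y * η)
    (hetu : η * u = u * η) (hetv : η * v = v * η) :
    (ξ * x + η * v) * (ξ * u + η * y) - (ξ * u + η * y) * (ξ * x + η * v)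
      = h * ((ξ * x + η * v) * (ξ * x + η * v)) := by
  have key : v * u - y * x - h * (v * x) = -1 := by
    have e : v * u - y * x - h * (v * x)
        = (v * u - u * v - h * (x * v + v * y)) + (x * y - y * x - h * (x * v - y * v))
          - (x * y - u * v - h * (x * v))
          + h * ((v * y - y * v) - (v * x - x * v)) := by noncomm_ring
    rw [e, hvu, hxy, hdet, hvy, hvx]
    noncomm_ring
  -- move the plane coordinates past the group coordinates
  have mv : ∀ p q a b : B, q * a = a * q → (p * a) * (q * b) = (p * q) * (a * b) := by
    intro p q a b hq
    rw [mul_assoc, ← mul_assoc a, ← hq, mul_assoc q, ← mul_assoc p]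
  have hm : ∀ p a : B, h * (p * a) = p * (h * a) := by
    intro p a
    rw [← mul_assoc, hc p, mul_assoc]
  have A : (ξ * x + η * v) * (ξ * u + η * y)
      = ξ * ξ * (x * u) + ξ * η * (x * y) + η * ξ * (v * u) + η * η * (v * y) := by
    rw [add_mul, mul_add, mul_add, mv _ _ _ _ hxix, mv _ _ _ _ hetx, mv _ _ _ _ hxiv,
      mv _ _ _ _ hetv]
    abel
  have C : (ξ * u + η * y) * (ξ * x + η * v)
      = ξ * ξ * (u * x) + ξ * η * (u * v) + η * ξ * (y * x) + η * η * (y * v) := by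
    rw [add_mul, mul_add, mul_add, mv _ _ _ _ hxiu, mv _ _ _ _ hetu, mv _ _ _ _ hxiy,
      mv _ _ _ _ hety]
    abel
  have D : h * ((ξ * x + η * v) * (ξ * x + η * v))
      = ξ * ξ * (h * (x * x)) + ξ * η * (h * (x * v)) + η * ξ * (h * (v * x))
        + η * η * (h * (v * v)) := by
    rw [add_mul, mul_add (ξ * x), mul_add (η * v), mv _ _ _ _ hxix, mv _ _ _ _ hetx, mv _ _ _ _ hxiv,
      mv _ _ _ _ hetv, mul_add, mul_add, mul_add, hm (ξ * ξ), hm (ξ * η),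
      hm (η * ξ), hm (η * η)]
    abel
  rw [A, C, D, ← sub_eq_zero]
  have e : ∀ P Q R S : B,
      P * (x * u) + Q * (x * y) + R * (v * u) + S * (v * y)
        - (P * (u * x) + Q * (u * v) + R * (y * x) + S * (y * v))
        - (P * (h * (x * x)) + Q * (h * (x * v)) + R * (h * (v * x)) + S * (h * (v * v)))
      = Q * (x * y - u * v - h * (x * v)) + R * (v * u - y * x - h * (v * x))
        + S * (v * y - y * v - h * (v * v)) - P * (u * x - x * u + h * (x * x)) := by
    intro P Q R S
    simp only [mul_add, mul_sub]
    abel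
  have e2 : h * (1 - x * x) + h * (x * x) = h := by noncomm_ring
  rw [e, hdet, key, hvy, hux, e2, ← hc, ← hplane]
  noncomm_ring
end

section
/- Let B be a unital associative ring with a central element h and elements ξ, η satisfying ξη − ηξ = hξ². Then for all nonnegative integers p and q (corresponding to p = j+m and q = j−m), ξ^{p} (η − hpξ)(η − h(p−1)ξ) ⋯ (η − h(p−q+1)ξ) = η (η + hξ)(η + 2hξ) ⋯ (η + (q−1)hξ) ξ^{p}, where both products have q factors taken left to right in the indicated order (the equality of the two explicit forms of the SL_h(2) representation bases on the quantum h-plane). -/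
/-- In a unital associative ring `B` with a central element `h` and
elements `ξ, η` satisfying `ξη - ηξ = hξ²`, for all nonnegative integers `p`, `q`:
`ξ^p (η - hpξ)(η - h(p-1)ξ) ⋯ (η - h(p-q+1)ξ)
   = η (η + hξ)(η + 2hξ) ⋯ (η + (q-1)hξ) ξ^p`,
both products having `q` factors taken left to right in the indicated order. -/
theorem stmt15 {B : Type*} [Ring B] (h ξ η : B)
    (hc : ∀ b : B, h * b = b * h)
    (hplane : ξ * η - η * ξ = h * (ξ * ξ))
    (p q : ℕ) :
    ξ ^ p * ((List.range q).map (fun i => η - ((p : ℤ) - (i : ℤ)) • (h * ξ))).prod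
      = ((List.range q).map (fun s => η + (s : ℤ) • (h * ξ))).prod * ξ ^ p := by
  have hcomm : Commute ξ (h * ξ) := by
    have : ξ * (h * ξ) = (h * ξ) * ξ := by
      rw [← mul_assoc, ← hc ξ]
    exact this
  have h1 : ξ * η = (η + h * ξ) * ξ := by
    rw [add_mul, mul_assoc h, ← hplane]; abel
  have h1' : SemiconjBy ξ η (η + h * ξ) := h1
  have key : ∀ n : ℕ, SemiconjBy (ξ ^ n) η (η + (n : ℤ) • (h * ξ)) := by
    intro n
    induction n with
    | zero => simp
    | succ n ih =>
      have h2 : SemiconjBy ξ ((n : ℤ) • (h * ξ)) ((n : ℤ) • (h * ξ)) :=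
        by
          unfold SemiconjBy; rw [mul_smul_comm, smul_mul_assoc, hcomm.eq]
      have h3 := (h1'.add_right h2).mul_left ih
      rw [← pow_succ'] at h3
      have e : η + ((n + 1 : ℕ) : ℤ) • (h * ξ) = η + h * ξ + (n : ℤ) • (h * ξ) := by
        push_cast
        rw [add_smul, one_smul]; abel
      rw [e]; exact h3
  have fac : ∀ i : ℕ, SemiconjBy (ξ ^ p) (η - ((p : ℤ) - (i : ℤ)) • (h * ξ))
      (η + (i : ℤ) • (h * ξ)) := by
    intro i
    have h2 : SemiconjBy (ξ ^ p) (((p : ℤ) - (i : ℤ)) • (h * ξ))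
        (((p : ℤ) - (i : ℤ)) • (h * ξ)) :=
      by
      unfold SemiconjBy; rw [mul_smul_comm, smul_mul_assoc, (hcomm.pow_left p).eq]
    have h3 := (key p).sub_right h2
    have e : η + (i : ℤ) • (h * ξ)
        = η + (p : ℤ) • (h * ξ) - ((p : ℤ) - (i : ℤ)) • (h * ξ) := by
      rw [sub_smul]; abel
    rw [e]; exact h3
  induction q with
  | zero => simp
  | succ q ih =>
    simp only [List.range_succ, List.bind_eq_flatMap, List.pure_def, List.flatMap_append,
      List.flatMap_cons, List.flatMap_nil, List.append_nil, List.map_append, List.prod_append,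
      List.map_cons, List.map_nil, List.prod_cons, List.prod_nil, mul_one] at ih ⊢
    rw [← mul_assoc, ih, mul_assoc, (fac q).eq, mul_assoc]
end

section
/- Let B be a unital associative ℝ-algebra with a central element h, elements ξ, η with ξη − ηξ = hξ², and elements x, y, u, v satisfying the SL_h(2) relations and the determinant relation, commuting with ξ and η. Define Φ̃₁₁(ξ,η) := ξ²/√2, Φ̃₁₀(ξ,η) := ηξ, Φ̃₁₋₁(ξ,η) := η(η + hξ)/√2, and set ξ' := ξx + ηv, η' := ξu + ηy. Then Φ̃₁ₘ(ξ',η') = Σ_{k∈{1,0,−1}} Φ̃₁ₖ(ξ,η) d¹_{km} for m ∈ {1,0,−1}, where the 3×3 matrix d¹ (rows k and columns m ordered 1, 0, −1) is: d¹₁₁ = x² + hxv, d¹₁₀ = √2(ux + huv), d¹₁₋₁ = u² + hu(x + y + hv); d¹₀₁ = √2 xv, d¹₀₀ = 1 + 2uv, d¹₀₋₁ = √2(uy + huv); d¹₋₁₁ = v², d¹₋₁₀ = √2 yv, d¹₋₁₋₁ = y² + hyv. This matrix is the spin-1 d-function of the Jordanian quantum group SL_h(2). -/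
noncomputable section

theorem plane_mul {B : Type*} [Ring B] (h ξ η a b c d : B)
    (hc : ∀ b : B, h * b = b * h)
    (hplane : ξ * η - η * ξ = h * (ξ * ξ))
    (h1 : ξ * a = a * ξ) (h2 : η * a = a * η) (h3 : ξ * b = b * ξ) (h4 : η * b = b * η) :
    (ξ * a + η * b) * (ξ * c + η * d)
      = ξ * ξ * (a * c + h * (a * d)) + η * ξ * (a * d + b * c) + η * η * (b * d) := by
  have e : ξ * η = η * ξ + ξ * ξ * h := by rw [← hc, ← hplane]; abel
  have e1 : ξ * a * (ξ * c) = ξ * ξ * (a * c) := by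
    rw [mul_assoc ξ a, ← mul_assoc a ξ, ← h1]; simp only [mul_assoc]
  have e2 : ξ * a * (η * d) = ξ * η * (a * d) := by
    rw [mul_assoc ξ a, ← mul_assoc a η, ← h2]; simp only [mul_assoc]
  have e3 : η * b * (ξ * c) = η * ξ * (b * c) := by
    rw [mul_assoc η b, ← mul_assoc b ξ, ← h3]; simp only [mul_assoc]
  have e4 : η * b * (η * d) = η * η * (b * d) := by
    rw [mul_assoc η b, ← mul_assoc b η, ← h4]; simp only [mul_assoc]
  rw [add_mul, mul_add, mul_add, e1, e2, e3, e4, e]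
  noncomm_ring

/-- Let `B` be a unital associative `ℝ`-algebra with a central
element `h`, elements `ξ, η` with `ξη - ηξ = hξ²`, and elements `x, y, u, v`
satisfying the `SL_h(2)` relations and the determinant relation, each commuting with
`ξ` and `η`.  With `Φ̃₁₁(ξ,η) = ξ²/√2`, `Φ̃₁₀(ξ,η) = ηξ`, `Φ̃₁₋₁(ξ,η) = η(η+hξ)/√2`
and `ξ' = ξx + ηv`, `η' = ξu + ηy`, one has
`Φ̃₁ₘ(ξ',η') = Σ_k Φ̃₁ₖ(ξ,η) d¹_{km}` where `d¹` is the spin-1 d-function of `SL_h(2)`. -/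
theorem stmt16 {B : Type*} [Ring B] [Algebra ℝ B] (h ξ η x y u v : B)
    (hc : ∀ b : B, h * b = b * h)
    (hplane : ξ * η - η * ξ = h * (ξ * ξ))
    (hvx : v * x - x * v = h * (v * v))
    (hux : u * x - x * u = h * (1 - x * x))
    (hvy : v * y - y * v = h * (v * v))
    (huy : u * y - y * u = h * (1 - y * y))
    (hxy : x * y - y * x = h * (x * v - y * v))
    (hvu : v * u - u * v = h * (x * v + v * y))
    (hdet : x * y - u * v - h * (x * v) = 1)
    (hxix : ξ * x = x * ξ) (hxiy : ξ * y = y * ξ)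
    (hxiu : ξ * u = u * ξ) (hxiv : ξ * v = v * ξ)
    (hetx : η * x = x * η) (hety : η * y = y * η)
    (hetu : η * u = u * η) (hetv : η * v = v * η)
    (ξ' η' : B) (hxi' : ξ' = ξ * x + η * v) (heta' : η' = ξ * u + η * y) :
    -- m = 1
    ((Real.sqrt 2)⁻¹ • (ξ' * ξ')
      = (Real.sqrt 2)⁻¹ • (ξ * ξ) * (x * x + h * (x * v))
        + (η * ξ) * (Real.sqrt 2 • (x * v))
        + (Real.sqrt 2)⁻¹ • (η * (η + h * ξ)) * (v * v))
    -- m = 0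
    ∧ (η' * ξ'
      = (Real.sqrt 2)⁻¹ • (ξ * ξ) * (Real.sqrt 2 • (u * x + h * (u * v)))
        + (η * ξ) * (1 + 2 * (u * v))
        + (Real.sqrt 2)⁻¹ • (η * (η + h * ξ)) * (Real.sqrt 2 • (y * v)))
    -- m = -1
    ∧ ((Real.sqrt 2)⁻¹ • (η' * (η' + h * ξ'))
      = (Real.sqrt 2)⁻¹ • (ξ * ξ) * (u * u + h * (u * (x + y + h * v)))
        + (η * ξ) * (Real.sqrt 2 • (u * y + h * (u * v)))
        + (Real.sqrt 2)⁻¹ • (η * (η + h * ξ)) * (y * y + h * (y * v))) := by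
  have P := plane_mul h ξ η
  have hs : Real.sqrt 2 = (Real.sqrt 2)⁻¹ * 2 := by
    have h2 : Real.sqrt 2 * Real.sqrt 2 = 2 := Real.mul_self_sqrt (by norm_num)
    have h0 : Real.sqrt 2 ≠ 0 := by positivity
    field_simp
    nlinarith
  have h0 : Real.sqrt 2 ≠ 0 := by positivity
  have k1 : ∀ a : B, (η * ξ) * (Real.sqrt 2 • a) = (Real.sqrt 2)⁻¹ • (η * ξ * (a + a)) := by
    intro a
    rw [mul_smul_comm]
    conv_lhs => rw [hs]
    rw [mul_smul, two_smul, mul_add]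
  have k2 : ∀ a b : B, (Real.sqrt 2)⁻¹ • a * (Real.sqrt 2 • b) = a * b := by
    intro a b
    rw [smul_mul_smul_comm, inv_mul_cancel₀ h0, one_smul]
  have k3 : ∀ a : B, η * (η + h * ξ) * a = η * η * a + η * ξ * (h * a) := by
    intro a
    rw [mul_add, add_mul, hc ξ]
    simp only [mul_assoc]
  have m0 : η' * ξ' = ξ * ξ * (u * x + h * (u * v)) + η * ξ * (u * v + y * x)
      + η * η * (y * v) := by
    rw [hxi', heta']
    exact P u y x v hc hplane hxiu hetu hxiy hety
  have r1 : v * x = x * v + h * (v * v) := by rw [← hvx]; abel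
  have r2 : y * x = 1 + u * v + h * (y * v) := by
    have e := hxy
    rw [mul_sub] at e
    rw [← hdet]
    have : y * x = x * y - (x * y - y * x) := by abel
    rw [this, e]; abel
  have r3 : y * u = u * y - h * (1 - y * y) := by rw [← huy]; abel
  refine ⟨?_, ?_, ?_⟩
  · rw [k1, smul_mul_assoc, smul_mul_assoc, ← smul_add, ← smul_add, k3, hxi',
      P x v x v hc hplane hxix hetx hxiv hetv, r1]
    congr 1
    noncomm_ring
  · rw [k2, k2, k3, m0, r2]
    noncomm_ring
  · have m1 : η' * η' = ξ * ξ * (u * u + h * (u * y)) + η * ξ * (u * y + y * u)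
        + η * η * (y * y) := by
      rw [heta']
      exact P u y u y hc hplane hxiu hetu hxiy hety
    have m2 : η' * (h * ξ') = η' * ξ' * h := by rw [hc ξ', mul_assoc]
    have c1 : ∀ a b : B, a * (h * b) = a * b * h := by
      intro a b; rw [hc b, mul_assoc]
    rw [k1, smul_mul_assoc, smul_mul_assoc, ← smul_add, ← smul_add, k3, mul_add η', m2, m1, m0,
      r2, r3]
    congr 1
    simp only [mul_add, mul_sub, add_mul, sub_mul, c1, hc, mul_one, one_mul, ← mul_assoc]
    abel
end
end
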